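/- (Pressure bound.) Let r>2. There exists a constant C=C(r,Γ)>0 with the following property. For all Ra>0, Pr>0, 0<L_s<∞, and all smooth functions p, u=(u₁,u₂), T on ℝ×[0,1], Γ-periodic in x₁, such that ∫_Ω p dx = 0, ∇·u=0 in Ω, u₂=0 at x₂∈{0,1}, T=1 at x₂=0, T=0 at x₂=1, and p solves the pressure Poisson problem Δp = −Pr⁻¹·∇uᵀ:∇u + Ra·∂₂T in Ω with Neumann data ∂₂p = L_s⁻¹·∂₁u₁ at x₂=1 and −∂₂p = L_s⁻¹·∂₁u₁ − Ra at x₂=0, one has ‖p‖_{H¹} ≤ C·(L_s⁻¹·‖∂₂u‖_{L²} + Pr⁻¹·‖ω‖_{L²}·‖ω‖_{L^r} + Ra·‖T‖_{L²}), where ω=∂₁u₂−∂₂u₁. -/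

import Mathlib

noncomputable section
open MeasureTheory Filter Set
open scoped ENNReal

namespace RB

/-- A time-dependent scalar field: arguments t, x₁, x₂. -/
abbrev TField := ℝ → ℝ → ℝ → ℝ
/-- A static scalar field: arguments x₁, x₂. -/
abbrev SField := ℝ → ℝ → ℝ

def tsmooth (f : TField) : Prop :=
  ContDiff ℝ (⊤ : ℕ∞) (fun q : ℝ × ℝ × ℝ => f q.1 q.2.1 q.2.2)
def ssmooth (f : SField) : Prop :=
  ContDiff ℝ (⊤ : ℕ∞) (fun q : ℝ × ℝ => f q.1 q.2)
def tperiodic (Γ : ℝ) (f : TField) : Prop := ∀ t x1 x2, f t (x1 + Γ) x2 = f t x1 x2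
def speriodic (Γ : ℝ) (f : SField) : Prop := ∀ x1 x2, f (x1 + Γ) x2 = f x1 x2

/-- time derivative -/
def dt (f : TField) : TField := fun t x1 x2 => deriv (fun s => f s x1 x2) t
/-- partial derivative in x₁ (time-dependent field) -/
def d1 (f : TField) : TField := fun t x1 x2 => deriv (fun y => f t y x2) x1
/-- partial derivative in x₂ (time-dependent field) -/
def d2 (f : TField) : TField := fun t x1 x2 => deriv (fun y => f t x1 y) x2
/-- partial derivative in x₁ (static field) -/
def q1 (f : SField) : SField := fun x1 x2 => deriv (fun y => f y x2) x1
/-- partial derivative in x₂ (static field) -/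
def q2 (f : SField) : SField := fun x1 x2 => deriv (fun y => f x1 y) x2

/-- Integral over Ω = [0,Γ]×[0,1]. -/
def intΩ (Γ : ℝ) (g : SField) : ℝ :=
  ∫ x1 in Ioc (0:ℝ) Γ, ∫ x2 in Ioc (0:ℝ) 1, g x1 x2

/-- Long-time horizontal average ⟨f⟩ of a quantity f(t, x₁). -/
def ltavg (Γ : ℝ) (f : ℝ → ℝ → ℝ) : ℝ :=
  limsup (fun t => (1/t) * ∫ s in Ioc (0:ℝ) t, (1/Γ) * ∫ x1 in Ioc (0:ℝ) Γ, f s x1) atTop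

/-- spatial L² norm of a static scalar field over Ω -/
def sL2 (Γ : ℝ) (f : SField) : ℝ := Real.sqrt (intΩ Γ (fun x1 x2 => f x1 x2 ^ 2))
/-- spatial L^r norm of a static scalar field over Ω -/
def sLr (Γ r : ℝ) (f : SField) : ℝ := (intΩ Γ (fun x1 x2 => |f x1 x2| ^ r)) ^ (1/r)
/-- H¹ norm of a static scalar field over Ω -/
def sH1 (Γ : ℝ) (f : SField) : ℝ :=
  Real.sqrt (intΩ Γ (fun x1 x2 => f x1 x2 ^ 2 + q1 f x1 x2 ^ 2 + q2 f x1 x2 ^ 2))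

/-- A classical solution of the Boussinesq system on Ω = [0,Γ]×[0,1] with
Rayleigh number Ra, Prandtl number Pr, slip length Ls ∈ (0,∞]
(Navier-slip with friction coefficient `(Ls⁻¹).toReal`; for Ls = ∞ this is free-slip). -/
structure Sol (Γ Ra Pr : ℝ) (Ls : ℝ≥0∞) where
  u1 : TField
  u2 : TField
  T : TField
  p : TField
  smooth_u1 : tsmooth u1
  smooth_u2 : tsmooth u2
  smooth_T : tsmooth T
  smooth_p : tsmooth p
  periodic_u1 : tperiodic Γ u1
  periodic_u2 : tperiodic Γ u2
  periodic_T : tperiodic Γ T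
  periodic_p : tperiodic Γ p
  momentum1 : ∀ t x1 x2, 0 ≤ t → x2 ∈ Icc (0:ℝ) 1 →
    Pr⁻¹ * (dt u1 t x1 x2 + u1 t x1 x2 * d1 u1 t x1 x2 + u2 t x1 x2 * d2 u1 t x1 x2)
      - (d1 (d1 u1) t x1 x2 + d2 (d2 u1) t x1 x2) + d1 p t x1 x2 = 0
  momentum2 : ∀ t x1 x2, 0 ≤ t → x2 ∈ Icc (0:ℝ) 1 →
    Pr⁻¹ * (dt u2 t x1 x2 + u1 t x1 x2 * d1 u2 t x1 x2 + u2 t x1 x2 * d2 u2 t x1 x2)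
      - (d1 (d1 u2) t x1 x2 + d2 (d2 u2) t x1 x2) + d2 p t x1 x2 = Ra * T t x1 x2
  incomp : ∀ t x1 x2, 0 ≤ t → x2 ∈ Icc (0:ℝ) 1 →
    d1 u1 t x1 x2 + d2 u2 t x1 x2 = 0
  heat : ∀ t x1 x2, 0 ≤ t → x2 ∈ Icc (0:ℝ) 1 →
    dt T t x1 x2 + u1 t x1 x2 * d1 T t x1 x2 + u2 t x1 x2 * d2 T t x1 x2
      - (d1 (d1 T) t x1 x2 + d2 (d2 T) t x1 x2) = 0
  T_bot : ∀ t x1, 0 ≤ t → T t x1 0 = 1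
  T_top : ∀ t x1, 0 ≤ t → T t x1 1 = 0
  u2_bot : ∀ t x1, 0 ≤ t → u2 t x1 0 = 0
  u2_top : ∀ t x1, 0 ≤ t → u2 t x1 1 = 0
  slip_top : ∀ t x1, 0 ≤ t → d2 u1 t x1 1 = -(Ls⁻¹).toReal * u1 t x1 1
  slip_bot : ∀ t x1, 0 ≤ t → d2 u1 t x1 0 = (Ls⁻¹).toReal * u1 t x1 0

variable {Γ Ra Pr : ℝ} {Ls : ℝ≥0∞}

/-- The Nusselt number Nu = ⟨∫₀¹ (u₂T − ∂₂T) dx₂⟩. -/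
def Nu (S : Sol Γ Ra Pr Ls) : ℝ :=
  ltavg Γ (fun t x1 => ∫ x2 in (0:ℝ)..1, (S.u2 t x1 x2 * S.T t x1 x2 - d2 S.T t x1 x2))

/-- The initial temperature satisfies 0 ≤ T₀ ≤ 1 on Ω. -/
def T0cond (S : Sol Γ Ra Pr Ls) : Prop :=
  ∀ x1 x2, x2 ∈ Icc (0:ℝ) 1 → S.T 0 x1 x2 ∈ Icc (0:ℝ) 1

/-- The vorticity ω = ∂₁u₂ − ∂₂u₁. -/
def vort (S : Sol Γ Ra Pr Ls) : TField :=
  fun t x1 x2 => d1 S.u2 t x1 x2 - d2 S.u1 t x1 x2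

/-- |∇u|² pointwise. -/
def gradSq (S : Sol Γ Ra Pr Ls) : TField := fun t x1 x2 =>
  d1 S.u1 t x1 x2 ^ 2 + d2 S.u1 t x1 x2 ^ 2 + d1 S.u2 t x1 x2 ^ 2 + d2 S.u2 t x1 x2 ^ 2

/-- |∇²u|² pointwise: sum of squares of all second spatial derivatives of u. -/
def hessSq (S : Sol Γ Ra Pr Ls) : TField := fun t x1 x2 =>
  d1 (d1 S.u1) t x1 x2 ^ 2 + d1 (d2 S.u1) t x1 x2 ^ 2 +
  d2 (d1 S.u1) t x1 x2 ^ 2 + d2 (d2 S.u1) t x1 x2 ^ 2 +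
  d1 (d1 S.u2) t x1 x2 ^ 2 + d1 (d2 S.u2) t x1 x2 ^ 2 +
  d2 (d1 S.u2) t x1 x2 ^ 2 + d2 (d2 S.u2) t x1 x2 ^ 2

/-- ‖u(t)‖_{L²}. -/
def uL2 (S : Sol Γ Ra Pr Ls) (t : ℝ) : ℝ :=
  Real.sqrt (intΩ Γ (fun x1 x2 => S.u1 t x1 x2 ^ 2 + S.u2 t x1 x2 ^ 2))

/-- ‖u₀‖_{W^{1,4}}. -/
def W14u0 (S : Sol Γ Ra Pr Ls) : ℝ :=
  (intΩ Γ (fun x1 x2 =>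
    (S.u1 0 x1 x2 ^ 2 + S.u2 0 x1 x2 ^ 2) ^ 2 + (gradSq S 0 x1 x2) ^ 2)) ^ ((1:ℝ)/4)

/-- ‖ω(t)‖_{L⁴}. -/
def omegaL4 (S : Sol Γ Ra Pr Ls) (t : ℝ) : ℝ :=
  (intΩ Γ (fun x1 x2 => vort S t x1 x2 ^ 4)) ^ ((1:ℝ)/4)


/-! ### Auxiliary material -/

/-- joint continuity of a static field -/
def scont (f : SField) : Prop := Continuous (fun q : ℝ × ℝ => f q.1 q.2)

def mu (Γ : ℝ) : Measure (ℝ × ℝ) :=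
  (volume.restrict (Ioc (0:ℝ) Γ)).prod (volume.restrict (Ioc (0:ℝ) 1))

lemma cont_integrableOn {L : ℝ} {f : ℝ → ℝ} (hf : Continuous f) :
    Integrable f (volume.restrict (Ioc (0:ℝ) L)) :=
  (hf.integrableOn_Icc (a := 0) (b := L)).mono_set Ioc_subset_Icc_self

lemma scont.integrable {f : SField} (hf : scont f) (Γ : ℝ) :
    Integrable (fun q : ℝ × ℝ => f q.1 q.2) (mu Γ) := by
  unfold mu
  rw [Measure.prod_restrict]
  have : IntegrableOn (fun q : ℝ × ℝ => f q.1 q.2) (Icc (0:ℝ) Γ ×ˢ Icc (0:ℝ) 1)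
      (volume.prod volume) := by
    apply ContinuousOn.integrableOn_compact (isCompact_Icc.prod isCompact_Icc)
    exact hf.continuousOn
  exact this.mono_set (prod_mono Ioc_subset_Icc_self Ioc_subset_Icc_self)

lemma intΩ_eq {f : SField} (hf : scont f) (Γ : ℝ) :
    intΩ Γ f = ∫ q, f q.1 q.2 ∂(mu Γ) := by
  unfold intΩ
  exact (integral_prod _ (hf.integrable Γ)).symm

lemma intΩ_swap {f : SField} (hf : scont f) (Γ : ℝ) :
    intΩ Γ f = ∫ x2 in Ioc (0:ℝ) 1, ∫ x1 in Ioc (0:ℝ) Γ, f x1 x2 := by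
  rw [intΩ_eq hf]
  exact integral_prod_symm _ (hf.integrable Γ)

lemma mu_ae (Γ : ℝ) : ∀ᵐ q ∂(mu Γ), q.1 ∈ Ioc (0:ℝ) Γ ∧ q.2 ∈ Ioc (0:ℝ) 1 := by
  unfold mu
  rw [Measure.prod_restrict]
  filter_upwards [ae_restrict_mem (measurableSet_Ioc.prod measurableSet_Ioc)] with q hq
  exact hq

lemma intΩ_mono {Γ : ℝ} {f g : SField} (hf : scont f) (hg : scont g)
    (h : ∀ x1 x2, x2 ∈ Icc (0:ℝ) 1 → f x1 x2 ≤ g x1 x2) : intΩ Γ f ≤ intΩ Γ g := by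
  rw [intΩ_eq hf, intΩ_eq hg]
  apply integral_mono_ae (hf.integrable Γ) (hg.integrable Γ)
  filter_upwards [mu_ae Γ] with q hq
  exact h _ _ (Ioc_subset_Icc_self hq.2)

lemma intΩ_congr {Γ : ℝ} {f g : SField} (hf : scont f) (hg : scont g)
    (h : ∀ x1 x2, x2 ∈ Icc (0:ℝ) 1 → f x1 x2 = g x1 x2) : intΩ Γ f = intΩ Γ g :=
  le_antisymm (intΩ_mono hf hg fun a b hb => (h a b hb).le)
    (intΩ_mono hg hf fun a b hb => (h a b hb).ge)

lemma intΩ_add {Γ : ℝ} {f g : SField} (hf : scont f) (hg : scont g) :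
    intΩ Γ (fun x y => f x y + g x y) = intΩ Γ f + intΩ Γ g := by
  have : scont (fun x y => f x y + g x y) := by unfold scont at *; fun_prop
  rw [intΩ_eq hf, intΩ_eq hg, intΩ_eq this]
  exact integral_add (hf.integrable Γ) (hg.integrable Γ)

lemma intΩ_const_mul {Γ : ℝ} {f : SField} (c : ℝ) :
    intΩ Γ (fun x y => c * f x y) = c * intΩ Γ f := by
  unfold intΩ
  simp only [integral_const_mul]

lemma intΩ_nonneg {Γ : ℝ} {f : SField} 
    (h : ∀ x1 x2, x2 ∈ Icc (0:ℝ) 1 → 0 ≤ f x1 x2) : 0 ≤ intΩ Γ f := by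
  unfold intΩ
  refine integral_nonneg fun x => ?_
  refine setIntegral_nonneg measurableSet_Ioc fun y hy => h _ _ (Ioc_subset_Icc_self hy)

lemma intΩ_const {Γ : ℝ} (hΓ : 0 < Γ) (c : ℝ) : intΩ Γ (fun _ _ => c) = Γ * c := by
  unfold intΩ
  simp [hΓ.le]

lemma intΩ_div {Γ : ℝ} (hΓ : 0 < Γ) {G H g h : SField}
    (hg : scont g) (hh : scont h) 
    (hG : ∀ x1 x2, HasDerivAt (fun y => G y x2) (g x1 x2) x1)
    (hH : ∀ x1 x2, HasDerivAt (fun y => H x1 y) (h x1 x2) x2)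
    (hper : ∀ x2, G Γ x2 = G 0 x2) (hb0 : ∀ x1, H x1 0 = 0) (hb1 : ∀ x1, H x1 1 = 0) :
    intΩ Γ (fun x y => g x y + h x y) = 0 := by
  rw [intΩ_add hg hh, intΩ_swap hg]
  have h1 : ∀ x2, ∫ x1 in Ioc (0:ℝ) Γ, g x1 x2 = 0 := by
    intro x2
    rw [← intervalIntegral.integral_of_le hΓ.le]
    rw [intervalIntegral.integral_eq_sub_of_hasDerivAt (fun x _ => hG x x2)]
    · rw [hper]; ring
    · apply Continuous.intervalIntegrable
      unfold scont at hg; fun_prop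
  have h2 : ∀ x1, ∫ x2 in Ioc (0:ℝ) 1, h x1 x2 = 0 := by
    intro x1
    rw [← intervalIntegral.integral_of_le zero_le_one]
    rw [intervalIntegral.integral_eq_sub_of_hasDerivAt (fun x _ => hH x1 x)]
    · rw [hb0, hb1]; ring
    · apply Continuous.intervalIntegrable
      unfold scont at hh; fun_prop
  unfold intΩ
  simp [h1, h2]

/-- Cauchy–Schwarz -/
lemma cs_int {α : Type*} [MeasurableSpace α] (μ : Measure α) (f g : α → ℝ)
    (hf : Integrable (fun x => f x ^ 2) μ) (hg : Integrable (fun x => g x ^ 2) μ)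
    (hfg : Integrable (fun x => f x * g x) μ) :
    (∫ x, f x * g x ∂μ) ^ 2 ≤ (∫ x, f x ^ 2 ∂μ) * ∫ x, g x ^ 2 ∂μ := by
  have key : ∀ t : ℝ, 0 ≤ (∫ x, f x ^ 2 ∂μ) * (t * t) + (2 * ∫ x, f x * g x ∂μ) * t
      + ∫ x, g x ^ 2 ∂μ := by
    intro t
    have : ∫ x, (t * f x + g x) ^ 2 ∂μ = (∫ x, f x ^ 2 ∂μ) * (t * t)
        + (2 * ∫ x, f x * g x ∂μ) * t + ∫ x, g x ^ 2 ∂μ := by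
      have e : ∀ x, (t * f x + g x) ^ 2 = (t * t) * f x ^ 2 + (2 * t) * (f x * g x) + g x ^ 2 := by
        intro x; ring
      simp only [e]
      have h12 : Integrable (fun x => (t * t) * f x ^ 2 + (2 * t) * (f x * g x)) μ :=
        (hf.const_mul _).add (hfg.const_mul _)
      rw [integral_add h12 hg, integral_add (hf.const_mul _) (hfg.const_mul _), integral_const_mul, integral_const_mul]
      ring
    rw [← this]
    exact integral_nonneg fun x => sq_nonneg _
  have := discrim_le_zero key
  unfold discrim at this
  nlinarith

lemma intΩ_cs {Γ : ℝ} {f g : SField} (hf : scont f) (hg : scont g) :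
    (intΩ Γ (fun x y => f x y * g x y)) ^ 2 ≤
      intΩ Γ (fun x y => f x y ^ 2) * intΩ Γ (fun x y => g x y ^ 2) := by
  have h1 : scont (fun x y => f x y ^ 2) := by unfold scont at *; fun_prop
  have h2 : scont (fun x y => g x y ^ 2) := by unfold scont at *; fun_prop
  have h3 : scont (fun x y => f x y * g x y) := by unfold scont at *; fun_prop
  rw [intΩ_eq h1, intΩ_eq h2, intΩ_eq h3]
  exact cs_int _ _ _ (h1.integrable Γ) (h2.integrable Γ) (h3.integrable Γ)

lemma cs_one {L : ℝ} (hL : 0 < L) {f : ℝ → ℝ} (hf : Continuous f) :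
    (∫ x in Ioc (0:ℝ) L, f x) ^ 2 ≤ L * ∫ x in Ioc (0:ℝ) L, f x ^ 2 := by
  have := cs_int (volume.restrict (Ioc (0:ℝ) L)) (fun _ => 1) f
    (cont_integrableOn (by fun_prop)) (cont_integrableOn (by fun_prop))
    (cont_integrableOn (by fun_prop))
  simpa [hL.le] using this

/-! smooth calculus -/

lemma ssmooth.scont {f : SField} (hf : ssmooth f) : scont f := ContDiff.continuous hf

lemma ssmooth.h1 {f : SField} (hf : ssmooth f) (x1 x2 : ℝ) :
    HasDerivAt (fun y => f y x2) (q1 f x1 x2) x1 := by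
  unfold q1
  apply DifferentiableAt.hasDerivAt
  unfold ssmooth at hf
  have : ContDiff ℝ (⊤ : ℕ∞) (fun y => f y x2) :=
    hf.comp (f := fun y : ℝ => (y, x2)) (by fun_prop)
  exact (this.differentiable (by simp)).differentiableAt

lemma ssmooth.h2 {f : SField} (hf : ssmooth f) (x1 x2 : ℝ) :
    HasDerivAt (fun y => f x1 y) (q2 f x1 x2) x2 := by
  unfold q2
  apply DifferentiableAt.hasDerivAt
  unfold ssmooth at hf
  have : ContDiff ℝ (⊤ : ℕ∞) (fun y => f x1 y) :=
    hf.comp (f := fun y : ℝ => (x1, y)) (by fun_prop)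
  exact (this.differentiable (by simp)).differentiableAt

lemma ssmooth.q1_eq {f : SField} (hf : ssmooth f) (x1 x2 : ℝ) :
    q1 f x1 x2 = fderiv ℝ (fun q : ℝ × ℝ => f q.1 q.2) (x1, x2) (1, 0) := by
  unfold ssmooth at hf
  have h := ((hf.differentiable (by simp)) (x1, x2)).hasFDerivAt
  have h2 : HasDerivAt (fun y : ℝ => (y, x2)) ((1:ℝ), (0:ℝ)) x1 :=
    (hasDerivAt_id x1).prodMk (hasDerivAt_const x1 x2)
  exact (h.comp_hasDerivAt x1 h2).deriv

lemma ssmooth.q2_eq {f : SField} (hf : ssmooth f) (x1 x2 : ℝ) :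
    q2 f x1 x2 = fderiv ℝ (fun q : ℝ × ℝ => f q.1 q.2) (x1, x2) (0, 1) := by
  unfold ssmooth at hf
  have h := ((hf.differentiable (by simp)) (x1, x2)).hasFDerivAt
  have h2 : HasDerivAt (fun y : ℝ => (x1, y)) ((0:ℝ), (1:ℝ)) x2 :=
    (hasDerivAt_const x2 x1).prodMk (hasDerivAt_id x2)
  exact (h.comp_hasDerivAt x2 h2).deriv

lemma ssmooth.q1 {f : SField} (hf : ssmooth f) : ssmooth (q1 f) := by
  have : RB.q1 f = fun x1 x2 => fderiv ℝ (fun q : ℝ × ℝ => f q.1 q.2) (x1, x2) (1, 0) := by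
    funext x y; exact hf.q1_eq x y
  unfold ssmooth at *
  rw [this]
  exact (hf.fderiv_right (m := (⊤ : ℕ∞)) (by simp)).clm_apply contDiff_const

lemma ssmooth.q2 {f : SField} (hf : ssmooth f) : ssmooth (q2 f) := by
  have : RB.q2 f = fun x1 x2 => fderiv ℝ (fun q : ℝ × ℝ => f q.1 q.2) (x1, x2) (0, 1) := by
    funext x y; exact hf.q2_eq x y
  unfold ssmooth at *
  rw [this]
  exact (hf.fderiv_right (m := (⊤ : ℕ∞)) (by simp)).clm_apply contDiff_const

lemma ssmooth.mixed {f : SField} (hf : ssmooth f) (x1 x2 : ℝ) :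
    RB.q1 (RB.q2 f) x1 x2 = RB.q2 (RB.q1 f) x1 x2 := by
  rw [hf.q2.q1_eq, hf.q1.q2_eq]
  have e1 : (fun q : ℝ × ℝ => RB.q2 f q.1 q.2) =
      fun q => fderiv ℝ (fun q : ℝ × ℝ => f q.1 q.2) q (0, 1) := by
    funext q; exact hf.q2_eq _ _
  have e2 : (fun q : ℝ × ℝ => RB.q1 f q.1 q.2) =
      fun q => fderiv ℝ (fun q : ℝ × ℝ => f q.1 q.2) q (1, 0) := by
    funext q; exact hf.q1_eq _ _
  rw [e1, e2]
  unfold ssmooth at hf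
  have hd : DifferentiableAt ℝ (fderiv ℝ (fun q : ℝ × ℝ => f q.1 q.2)) (x1, x2) :=
    ((hf.fderiv_right (m := (⊤ : ℕ∞)) (by simp)).differentiable (by simp)) _
  rw [fderiv_clm_apply hd (differentiableAt_const _), fderiv_clm_apply hd (differentiableAt_const _)]
  have hs : IsSymmSndFDerivAt ℝ (fun q : ℝ × ℝ => f q.1 q.2) (x1, x2) :=
    hf.contDiffAt.isSymmSndFDerivAt (by
      rw [minSmoothness_of_isRCLikeNormedField]
      exact WithTop.coe_le_coe.2 (le_top : (2 : ℕ∞) ≤ ⊤))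
  simp
  exact hs _ _

lemma q1_per {Γ : ℝ} {f : SField} (h : speriodic Γ f) : speriodic Γ (q1 f) := by
  intro x y
  unfold q1
  rw [← deriv_comp_add_const (f := fun z => f z y)]
  congr 1
  funext z
  exact h z y

lemma q2_per {Γ : ℝ} {f : SField} (h : speriodic Γ f) : speriodic Γ (q2 f) := by
  intro x y
  unfold q2
  congr 1
  funext z
  exact h x z

lemma per0 {Γ : ℝ} {f : SField} (h : speriodic Γ f) (y : ℝ) : f Γ y = f 0 y := by
  simpa using h 0 y

lemma osc_le {L : ℝ} {f f' : ℝ → ℝ} (hf : ∀ x, HasDerivAt f (f' x) x) (hc : Continuous f')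
    {x y : ℝ} (hx : x ∈ Icc 0 L) (hy : y ∈ Icc 0 L) :
    |f x - f y| ≤ ∫ s in Ioc (0:ℝ) L, |f' s| := by
  rw [← intervalIntegral.integral_eq_sub_of_hasDerivAt (fun z _ => hf z)
    (hc.intervalIntegrable y x)]
  refine (intervalIntegral.norm_integral_le_integral_norm_uIoc (f := f')).trans ?_
  apply setIntegral_mono_set (cont_integrableOn (by fun_prop))
  · exact Eventually.of_forall fun z => abs_nonneg _
  · apply LE.le.eventuallyLE
    intro z hz
    rw [uIoc] at hz
    exact ⟨lt_of_le_of_lt (le_min hy.1 hx.1) hz.1, hz.2.trans (max_le hy.2 hx.2)⟩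

lemma osc_sq_le {L : ℝ} (hL : 0 < L) {f f' : ℝ → ℝ} (hf : ∀ x, HasDerivAt f (f' x) x)
    (hc : Continuous f') {x y : ℝ} (hx : x ∈ Icc 0 L) (hy : y ∈ Icc 0 L) :
    (f x - f y) ^ 2 ≤ L * ∫ s in Ioc (0:ℝ) L, f' s ^ 2 := by
  have h1 := osc_le hf hc hx hy
  have h2 := cs_one hL (f := fun s => |f' s|) (by fun_prop)
  simp only [sq_abs] at h2
  refine le_trans ?_ h2
  rw [← sq_abs]
  gcongr

lemma sup_le {L : ℝ} (hL : 0 < L) {f f' : ℝ → ℝ} (hf : ∀ x, HasDerivAt f (f' x) x)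
    (hc : Continuous f') {x : ℝ} (hx : x ∈ Icc 0 L) :
    |f x| ≤ ∫ s in Ioc (0:ℝ) L, (L⁻¹ * |f s| + |f' s|) := by
  have hfc : Continuous f := continuous_iff_continuousAt.2 fun x => (hf x).continuousAt
  have h0 : ∫ s in Ioc (0:ℝ) L, |f x| ≤
      ∫ s in Ioc (0:ℝ) L, (|f s| + ∫ t in Ioc (0:ℝ) L, |f' t|) := by
    apply setIntegral_mono_on (cont_integrableOn (by fun_prop)) (cont_integrableOn (by fun_prop))
      measurableSet_Ioc
    intro s hs
    have := osc_le hf hc hx (Ioc_subset_Icc_self hs)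
    have h3 := abs_sub_abs_le_abs_sub (f x) (f s)
    linarith
  rw [integral_add (cont_integrableOn (by fun_prop)) (cont_integrableOn (by fun_prop))] at h0
  rw [integral_add (cont_integrableOn (by fun_prop)) (cont_integrableOn (by fun_prop)),
    integral_const_mul]
  simp only [integral_const, MeasurableSet.univ, measureReal_restrict_apply, univ_inter,
    Real.volume_real_Ioc, sub_zero, max_eq_left hL.le, smul_eq_mul] at h0
  have h4 : |f x| = L⁻¹ * (L * |f x|) := by field_simp
  rw [h4]
  calc L⁻¹ * (L * |f x|) ≤ L⁻¹ * ((∫ s in Ioc (0:ℝ) L, |f s|) + L * ∫ t in Ioc (0:ℝ) L, |f' t|) := by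
        gcongr
    _ = _ := by field_simp

lemma poinc1 {L K : ℝ} (hL : 0 < L) {f : ℝ → ℝ} (hf : Continuous f)
    (h : ∀ x ∈ Icc 0 L, ∀ y ∈ Icc 0 L, (f x - f y) ^ 2 ≤ K) :
    ∫ x in Ioc (0:ℝ) L, f x ^ 2 ≤ L⁻¹ * (∫ x in Ioc (0:ℝ) L, f x) ^ 2 + L * K := by
  set I := ∫ x in Ioc (0:ℝ) L, f x with hI
  have hp : ∀ x ∈ Ioc 0 L, f x ^ 2 ≤ K + (2 * (L⁻¹ * I)) * f x - (L⁻¹ * I) ^ 2 := by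
    intro x hx
    have hx' := Ioc_subset_Icc_self hx
    have h1 := cs_one hL (f := fun y => f x - f y) (by fun_prop)
    have h2 : ∫ y in Ioc (0:ℝ) L, (f x - f y) ^ 2 ≤ ∫ y in Ioc (0:ℝ) L, K :=
      setIntegral_mono_on (cont_integrableOn (by fun_prop)) (cont_integrableOn (by fun_prop))
        measurableSet_Ioc fun y hy => h x hx' y (Ioc_subset_Icc_self hy)
    rw [integral_sub (cont_integrableOn (by fun_prop)) (cont_integrableOn (by fun_prop))] at h1
    simp [hL.le] at h1 h2
    rw [← hI] at h1
    have h3 : (L * f x - I) ^ 2 ≤ L * (L * K) := h1.trans (by gcongr)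
    have h4 : (f x - L⁻¹ * I) ^ 2 ≤ K := by
      have : (f x - L⁻¹ * I) ^ 2 = (L * f x - I) ^ 2 / L ^ 2 := by field_simp
      rw [this, div_le_iff₀ (by positivity)]
      linarith
    nlinarith
  have h5 := setIntegral_mono_on (cont_integrableOn (by fun_prop))
    (cont_integrableOn (by fun_prop)) measurableSet_Ioc hp
  rw [integral_sub (cont_integrableOn (by fun_prop)) (cont_integrableOn (by fun_prop)),
    integral_add (cont_integrableOn (by fun_prop)) (cont_integrableOn (by fun_prop)),
    integral_const_mul, ← hI] at h5
  simp [hL.le] at h5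
  refine h5.trans (le_of_eq ?_)
  field_simp
  ring

lemma par_cont {F : ℝ → ℝ → ℝ} (hF : Continuous (fun q : ℝ × ℝ => F q.1 q.2)) {L : ℝ}
    (hL : 0 < L) : Continuous (fun x => ∫ y in Ioc (0:ℝ) L, F x y) := by
  simp only [← intervalIntegral.integral_of_le hL.le]
  exact intervalIntegral.continuous_parametric_intervalIntegral_of_continuous' hF 0 L

lemma poincare {Γ : ℝ} (hΓ : 0 < Γ) {v : SField} (hv : ssmooth v) (h0 : intΩ Γ v = 0) :
    intΩ Γ (fun x y => v x y ^ 2) ≤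
      (1 + Γ ^ 2) * intΩ Γ (fun x y => q1 v x y ^ 2 + q2 v x y ^ 2) := by
  have c0 : Continuous (fun q : ℝ × ℝ => v q.1 q.2) := hv.scont
  have c1 : Continuous (fun q : ℝ × ℝ => q1 v q.1 q.2) := hv.q1.scont
  have c2 : Continuous (fun q : ℝ × ℝ => q2 v q.1 q.2) := hv.q2.scont
  have s0 : scont (fun x y => v x y ^ 2) := by unfold scont; fun_prop
  have s1 : scont (fun x y => q1 v x y ^ 2) := by unfold scont; fun_prop
  have s2 : scont (fun x y => q2 v x y ^ 2) := by unfold scont; fun_prop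
  set M : ℝ → ℝ := fun y => ∫ x in Ioc (0:ℝ) Γ, v x y with hM
  have cM : Continuous M := par_cont (F := fun y x => v x y) (by fun_prop) hΓ
  have cV : Continuous fun y => ∫ x in Ioc (0:ℝ) Γ, v x y ^ 2 :=
    par_cont (F := fun y x => v x y ^ 2) (by fun_prop) hΓ
  have cV1 : Continuous fun y => ∫ x in Ioc (0:ℝ) Γ, q1 v x y ^ 2 :=
    par_cont (F := fun y x => q1 v x y ^ 2) (by fun_prop) hΓ
  have cV2 : Continuous fun x => ∫ y in Ioc (0:ℝ) 1, q2 v x y ^ 2 :=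
    par_cont (F := fun x y => q2 v x y ^ 2) (by fun_prop) one_pos
  have hMint : ∫ y in Ioc (0:ℝ) 1, M y = 0 := (intΩ_swap hv.scont Γ).symm.trans h0
  have A : intΩ Γ (fun x y => v x y ^ 2) ≤
      Γ⁻¹ * (∫ y in Ioc (0:ℝ) 1, M y ^ 2) + Γ ^ 2 * intΩ Γ (fun x y => q1 v x y ^ 2) := by
    rw [intΩ_swap s0, intΩ_swap s1, ← integral_const_mul, ← integral_const_mul,
      ← integral_add (cont_integrableOn (by fun_prop)) (cont_integrableOn (by fun_prop))]
    apply integral_mono (cont_integrableOn (by fun_prop)) (cont_integrableOn (by fun_prop))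
    intro y
    have := poinc1 hΓ (f := fun x => v x y) (by fun_prop)
      (fun x hx z hz => osc_sq_le hΓ (fun x => hv.h1 x y) (by fun_prop) hx hz)
    refine this.trans (le_of_eq ?_)
    simp only [hM]; ring
  have B : ∫ y in Ioc (0:ℝ) 1, M y ^ 2 ≤ Γ * intΩ Γ (fun x y => q2 v x y ^ 2) := by
    have := poinc1 (K := Γ * intΩ Γ (fun x y => q2 v x y ^ 2)) one_pos cM ?_
    · rw [hMint] at this
      simpa using this
    · intro x hx y hy
      simp only [hM]
      rw [← integral_sub (cont_integrableOn (by fun_prop)) (cont_integrableOn (by fun_prop))]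
      refine (cs_one hΓ (by fun_prop)).trans ?_
      gcongr
      unfold intΩ
      apply integral_mono (cont_integrableOn (by fun_prop)) (cont_integrableOn (by fun_prop))
      intro s
      have := osc_sq_le one_pos (fun t => hv.h2 s t) (by fun_prop) hx hy
      simpa using this
  rw [intΩ_add s1 s2]
  have n1 : 0 ≤ intΩ Γ (fun x y => q1 v x y ^ 2) := intΩ_nonneg fun _ _ _ => sq_nonneg _
  have n2 : 0 ≤ intΩ Γ (fun x y => q2 v x y ^ 2) := intΩ_nonneg fun _ _ _ => sq_nonneg _
  have : Γ⁻¹ * ∫ y in Ioc (0:ℝ) 1, M y ^ 2 ≤ Γ⁻¹ * (Γ * intΩ Γ (fun x y => q2 v x y ^ 2)) := by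
    gcongr
  rw [inv_mul_cancel_left₀ hΓ.ne'] at this
  nlinarith [mul_nonneg (sq_nonneg Γ) n2]

/-- squared `H¹` norm -/
def EE (Γ : ℝ) (v : SField) : ℝ := intΩ Γ (fun x y => v x y ^ 2 + q1 v x y ^ 2 + q2 v x y ^ 2)

lemma sobolev_step {Γ : ℝ} (hΓ : 0 < Γ) {v : SField} (hv : ssmooth v) (m : ℕ) :
    intΩ Γ (fun x y => v x y ^ (2 * (m + 1))) ≤
      (2 * (1 + Γ⁻¹ ^ 2) + 2 * (m + 1) ^ 2) * intΩ Γ (fun x y => v x y ^ (2 * m)) * EE Γ v := by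
  have c0 : Continuous (fun q : ℝ × ℝ => v q.1 q.2) := hv.scont
  have c1 : Continuous (fun q : ℝ × ℝ => q1 v q.1 q.2) := hv.q1.scont
  have c2 : Continuous (fun q : ℝ × ℝ => q2 v q.1 q.2) := hv.q2.scont
  set X := intΩ Γ (fun x y => v x y ^ (2 * m)) with hX
  set E := EE Γ v with hE
  have hX0 : 0 ≤ X := intΩ_nonneg fun x y _ => by rw [pow_mul]; positivity
  have hE0 : 0 ≤ E := intΩ_nonneg fun x y _ => by positivity
  set F : SField := fun x y => Γ⁻¹ * |v x y ^ (m + 1)| + |(m + 1 : ℝ) * v x y ^ m * q1 v x y| with hF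
  set G : SField := fun x y => |v x y ^ (m + 1)| + |(m + 1 : ℝ) * v x y ^ m * q2 v x y| with hG
  have sF : Continuous (fun q : ℝ × ℝ => F q.1 q.2) := by simp only [hF]; fun_prop
  have sG : Continuous (fun q : ℝ × ℝ => G q.1 q.2) := by simp only [hG]; fun_prop
  set A : ℝ → ℝ := fun y => ∫ x in Ioc (0:ℝ) Γ, F x y with hA
  set B : ℝ → ℝ := fun x => ∫ y in Ioc (0:ℝ) 1, G x y with hB
  have cA : Continuous A := par_cont (F := fun y x => F x y) (by fun_prop) hΓ
  have cB : Continuous B := par_cont (F := fun x y => G x y) (by fun_prop) one_pos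
  have iA : ∫ y in Ioc (0:ℝ) 1, A y = intΩ Γ F := (intΩ_swap sF Γ).symm
  have iB : ∫ x in Ioc (0:ℝ) Γ, B x = intΩ Γ G := rfl
  have bA : ∀ x ∈ Ioc 0 Γ, ∀ y, |v x y ^ (m + 1)| ≤ A y := by
    intro x hx y
    refine (sup_le hΓ (f := fun x => v x y ^ (m + 1))
      (f' := fun x => (m + 1 : ℝ) * v x y ^ m * q1 v x y) ?_ (by fun_prop)
      (Ioc_subset_Icc_self hx))
    intro x
    simpa using (hv.h1 x y).fun_pow (m + 1)
  have bB : ∀ x, ∀ y ∈ Ioc (0:ℝ) 1, |v x y ^ (m + 1)| ≤ B x := by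
    intro x y hy
    refine (sup_le one_pos (f := fun y => v x y ^ (m + 1))
      (f' := fun y => (m + 1 : ℝ) * v x y ^ m * q2 v x y) ?_ (by fun_prop)
      (Ioc_subset_Icc_self hy)).trans (le_of_eq (by simp [hB, hG]))
    intro y
    simpa using (hv.h2 x y).fun_pow (m + 1)
  have s1 : scont (fun x y => v x y ^ (2 * (m + 1))) := by unfold scont; fun_prop
  have s2 : scont (fun x y => B x * A y) := by unfold scont; fun_prop
  have P1 : intΩ Γ (fun x y => v x y ^ (2 * (m + 1))) ≤ intΩ Γ (fun x y => B x * A y) := by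
    rw [intΩ_eq s1, intΩ_eq s2]
    apply integral_mono_ae (s1.integrable Γ) (s2.integrable Γ)
    filter_upwards [mu_ae Γ] with q hq
    have h1 := bA q.1 hq.1 q.2
    have h2 := bB q.1 q.2 hq.2
    have : v q.1 q.2 ^ (2 * (m + 1)) = |v q.1 q.2 ^ (m + 1)| * |v q.1 q.2 ^ (m + 1)| := by
      rw [abs_mul_abs_self]; ring
    rw [this]
    exact mul_le_mul h2 h1 (abs_nonneg _) ((abs_nonneg _).trans h2)
  have P2 : intΩ Γ (fun x y => B x * A y) = intΩ Γ G * intΩ Γ F := by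
    rw [← iA, ← iB]
    unfold intΩ
    simp only [integral_const_mul, integral_mul_const]
  have sv : scont (fun x y => |v x y| ^ m) := by unfold scont; fun_prop
  have X' : intΩ Γ (fun x y => (|v x y| ^ m) ^ 2) = X := by
    rw [hX]; congr 1; funext x y
    rw [← pow_mul, mul_comm, pow_mul, pow_mul, sq_abs]
  have QF : (intΩ Γ F) ^ 2 ≤ (2 * (1 + Γ⁻¹ ^ 2) + 2 * (m + 1) ^ 2) * X * E := by
    have := intΩ_cs (Γ := Γ) sv (g := fun x y => Γ⁻¹ * |v x y| + (m + 1) * |q1 v x y|)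
      (by unfold scont; fun_prop)
    rw [X'] at this
    have e : (fun x y => |v x y| ^ m * (Γ⁻¹ * |v x y| + (m + 1) * |q1 v x y|)) = F := by
      funext x y
      simp only [hF, abs_mul, abs_pow]
      rw [abs_of_nonneg (by positivity : (0:ℝ) ≤ m + 1)]
      ring
    rw [e] at this
    refine this.trans ?_
    have h3 : intΩ Γ (fun x y => (Γ⁻¹ * |v x y| + (m + 1) * |q1 v x y|) ^ 2) ≤
        (2 * (1 + Γ⁻¹ ^ 2) + 2 * (m + 1) ^ 2) * E := by
      rw [hE, EE, ← intΩ_const_mul]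
      apply intΩ_mono (by unfold scont; fun_prop) (by unfold scont; fun_prop)
      intro x y _
      rw [← sq_abs (v x y), ← sq_abs (q1 v x y)]
      have : 0 ≤ (2 * (1 + Γ⁻¹ ^ 2) + 2 * ((m:ℝ) + 1) ^ 2) * q2 v x y ^ 2 := by positivity
      have : 0 ≤ (2 * (1 + Γ⁻¹ ^ 2)) * |q1 v x y| ^ 2 := by positivity
      have : 0 ≤ (2  + 2 * ((m:ℝ) + 1) ^ 2) * |v x y| ^ 2 := by positivity
      linarith [sq_nonneg (Γ⁻¹ * |v x y| - (m + 1) * |q1 v x y|)]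
    calc _ ≤ X * ((2 * (1 + Γ⁻¹ ^ 2) + 2 * (m + 1) ^ 2) * E) := by gcongr
      _ = _ := by ring
  have QG : (intΩ Γ G) ^ 2 ≤ (2 * (1 + Γ⁻¹ ^ 2) + 2 * (m + 1) ^ 2) * X * E := by
    have := intΩ_cs (Γ := Γ) sv (g := fun x y => |v x y| + (m + 1) * |q2 v x y|)
      (by unfold scont; fun_prop)
    rw [X'] at this
    have e : (fun x y => |v x y| ^ m * (|v x y| + (m + 1) * |q2 v x y|)) = G := by
      funext x y
      simp only [hG, abs_mul, abs_pow]
      rw [abs_of_nonneg (by positivity : (0:ℝ) ≤ m + 1)]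
      ring
    rw [e] at this
    refine this.trans ?_
    have h3 : intΩ Γ (fun x y => (|v x y| + (m + 1) * |q2 v x y|) ^ 2) ≤
        (2 * (1 + Γ⁻¹ ^ 2) + 2 * (m + 1) ^ 2) * E := by
      rw [hE, EE, ← intΩ_const_mul]
      apply intΩ_mono (by unfold scont; fun_prop) (by unfold scont; fun_prop)
      intro x y _
      rw [← sq_abs (v x y), ← sq_abs (q2 v x y)]
      have : 0 ≤ (2 * (1 + Γ⁻¹ ^ 2) + 2 * ((m:ℝ) + 1) ^ 2) * q1 v x y ^ 2 := by positivity
      have : 0 ≤ (2 * (1 + Γ⁻¹ ^ 2)) * |q2 v x y| ^ 2 := by positivity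
      have : 0 ≤ (2 * Γ⁻¹ ^ 2 + 2 * ((m:ℝ) + 1) ^ 2) * |v x y| ^ 2 := by positivity
      linarith [sq_nonneg (|v x y| - (m + 1) * |q2 v x y|)]
    calc _ ≤ X * ((2 * (1 + Γ⁻¹ ^ 2) + 2 * (m + 1) ^ 2) * E) := by gcongr
      _ = _ := by ring
  calc _ ≤ _ := P1
    _ = _ := P2
    _ ≤ _ := by nlinarith [sq_nonneg (intΩ Γ G - intΩ Γ F)]

lemma sobolev {Γ : ℝ} (hΓ : 0 < Γ) (m : ℕ) : ∃ C : ℝ, 0 < C ∧ ∀ v : SField, ssmooth v →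
    intΩ Γ (fun x y => v x y ^ (2 * m)) ≤ C * EE Γ v ^ m := by
  induction m with
  | zero => exact ⟨Γ, hΓ, fun v _ => by simp [intΩ_const hΓ]⟩
  | succ m ih =>
    obtain ⟨C, hC, h⟩ := ih
    refine ⟨(2 * (1 + Γ⁻¹ ^ 2) + 2 * (m + 1) ^ 2) * C, by positivity, fun v hv => ?_⟩
    have hE0 : 0 ≤ EE Γ v := intΩ_nonneg fun x y _ => by positivity
    refine (sobolev_step hΓ hv m).trans ?_
    calc _ ≤ (2 * (1 + Γ⁻¹ ^ 2) + 2 * (m + 1) ^ 2) * (C * EE Γ v ^ m) * EE Γ v := by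
          gcongr; exact h v hv
      _ = _ := by ring

instance (Γ : ℝ) : IsFiniteMeasure (mu Γ) := by unfold mu; infer_instance

lemma scont.memLp {f : SField} (hf : scont f) (Γ : ℝ) (p : ℝ≥0∞) :
    MemLp (fun q : ℝ × ℝ => f q.1 q.2) p (mu Γ) := by
  have hf' : Continuous (fun q : ℝ × ℝ => f q.1 q.2) := hf
  obtain ⟨C, hC⟩ := (isCompact_Icc.prod isCompact_Icc :
    IsCompact (Icc (0:ℝ) Γ ×ˢ Icc (0:ℝ) 1)).exists_bound_of_continuousOn hf'.continuousOn
  apply MemLp.of_bound hf'.aestronglyMeasurable C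
  filter_upwards [mu_ae Γ] with q hq
  exact hC q ⟨Ioc_subset_Icc_self hq.1, Ioc_subset_Icc_self hq.2⟩

lemma intΩ_holder {Γ p q : ℝ} (hpq : p.HolderConjugate q) {f g : SField} (hf : scont f)
    (hg : scont g) (f0 : ∀ x y, 0 ≤ f x y) (g0 : ∀ x y, 0 ≤ g x y) :
    intΩ Γ (fun x y => f x y * g x y) ≤
      (intΩ Γ (fun x y => f x y ^ p)) ^ (1 / p) * (intΩ Γ (fun x y => g x y ^ q)) ^ (1 / q) := by
  have hf' : Continuous (fun q : ℝ × ℝ => f q.1 q.2) := hf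
  have hg' : Continuous (fun q : ℝ × ℝ => g q.1 q.2) := hg
  have h1 : scont (fun x y => f x y * g x y) := by unfold scont; fun_prop
  have h2 : scont (fun x y => f x y ^ p) := hf'.rpow_const fun _ => Or.inr hpq.nonneg
  have h3 : scont (fun x y => g x y ^ q) := hg'.rpow_const fun _ => Or.inr hpq.symm.nonneg
  rw [intΩ_eq h1, intΩ_eq h2, intΩ_eq h3]
  exact integral_mul_le_Lp_mul_Lq_of_nonneg hpq (Eventually.of_forall fun z => f0 _ _)
    (Eventually.of_forall fun z => g0 _ _) (hf.memLp _ _) (hg.memLp _ _)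

lemma holder_est {Γ : ℝ} (hΓ : 0 < Γ) {r : ℝ} (hr : 2 < r) : ∃ C : ℝ, 0 < C ∧
    ∀ a b w : SField, ssmooth a → ssmooth b → scont w →
    intΩ Γ (fun x y => (a x y ^ 2 + b x y ^ 2) * w x y ^ 2) ≤
      C * (EE Γ a + EE Γ b) * sLr Γ r w ^ 2 := by
  have hr2 : 0 < r - 2 := by linarith
  set s : ℝ := r / (r - 2) with hs
  have hs0 : 0 < s := by positivity
  have hconj : s.HolderConjugate (r / 2) := by
    rw [Real.holderConjugate_iff]
    refine ⟨?_, ?_⟩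
    · rw [hs, one_lt_div hr2]; linarith
    · rw [hs]; field_simp; ring
  obtain ⟨m, hm⟩ := exists_nat_gt s
  have hm0 : (0:ℝ) < m := hs0.trans hm
  have hmn : m ≠ 0 := by intro h; simp [h] at hm0
  have hconj2 : (m / s).HolderConjugate (Real.conjExponent (m / s)) :=
    Real.HolderConjugate.conjExponent ((one_lt_div hs0).2 hm)
  set t := Real.conjExponent (m / s) with ht
  obtain ⟨D, hD, hsob⟩ := sobolev hΓ m
  refine ⟨(2 ^ (m - 1) * D * 2) ^ (1 / (m:ℝ)) * ((Γ ^ (1 / t)) ^ (1 / s)), by positivity, ?_⟩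
  intro a b w ha hb hw
  have ca : Continuous (fun q : ℝ × ℝ => a q.1 q.2) := ha.scont
  have cb : Continuous (fun q : ℝ × ℝ => b q.1 q.2) := hb.scont
  have cw : Continuous (fun q : ℝ × ℝ => w q.1 q.2) := hw
  have hEa : 0 ≤ EE Γ a := intΩ_nonneg fun x y _ => by positivity
  have hEb : 0 ≤ EE Γ b := intΩ_nonneg fun x y _ => by positivity
  set F : SField := fun x y => a x y ^ 2 + b x y ^ 2 with hF
  have F0 : ∀ x y, 0 ≤ F x y := fun x y => by simp only [hF]; positivity
  have cF : Continuous (fun q : ℝ × ℝ => F q.1 q.2) := by simp only [hF]; fun_prop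
  have cFs : scont (fun x y => F x y ^ s) := cF.rpow_const fun _ => Or.inr hs0.le
  have H1 := intΩ_holder (Γ := Γ) hconj (f := F) (g := fun x y => w x y ^ 2) cF
    (by unfold scont; fun_prop) F0 (fun x y => sq_nonneg _)
  have e1 : (intΩ Γ (fun x y => (w x y ^ 2) ^ (r / 2))) ^ (1 / (r / 2)) = sLr Γ r w ^ 2 := by
    unfold sLr
    rw [← Real.rpow_mul_natCast (intΩ_nonneg fun x y _ => by positivity)]
    congr 1
    · congr 1
      funext x y
      rw [← sq_abs, ← Real.rpow_natCast, ← Real.rpow_mul (abs_nonneg _)]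
      congr 1
      push_cast; ring
    · push_cast; field_simp
  rw [e1] at H1
  have H2 := intΩ_holder (Γ := Γ) hconj2 (f := fun x y => F x y ^ s) (g := fun _ _ => 1) cFs
    (by unfold scont; fun_prop) (fun x y => Real.rpow_nonneg (F0 x y) _) (fun x y => zero_le_one)
  simp only [mul_one, Real.one_rpow, intΩ_const hΓ] at H2
  have e2 : (fun x y => (F x y ^ s) ^ (m / s)) = fun x y => F x y ^ m := by
    funext x y
    rw [← Real.rpow_mul (F0 x y), mul_div_cancel₀ _ hs0.ne', Real.rpow_natCast]
  rw [e2] at H2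
  have H3 : intΩ Γ (fun x y => F x y ^ m) ≤ (2 ^ (m - 1) * D * 2) * (EE Γ a + EE Γ b) ^ m := by
    have : intΩ Γ (fun x y => F x y ^ m) ≤
        intΩ Γ (fun x y => 2 ^ (m - 1) * (a x y ^ (2 * m) + b x y ^ (2 * m))) := by
      apply intΩ_mono (by unfold scont; fun_prop) (by unfold scont; fun_prop)
      intro x y _
      rw [pow_mul, pow_mul]
      exact add_pow_le (sq_nonneg _) (sq_nonneg _) m
    refine this.trans ?_
    rw [intΩ_const_mul, intΩ_add (by unfold scont; fun_prop) (by unfold scont; fun_prop)]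
    have h1 := hsob a ha
    have h2 := hsob b hb
    have h3 : EE Γ a ^ m ≤ (EE Γ a + EE Γ b) ^ m := by gcongr; linarith
    have h4 : EE Γ b ^ m ≤ (EE Γ a + EE Γ b) ^ m := by gcongr; linarith
    calc _ ≤ 2 ^ (m - 1) * (D * (EE Γ a + EE Γ b) ^ m + D * (EE Γ a + EE Γ b) ^ m) := by
          gcongr
          · exact h1.trans (by gcongr)
          · exact h2.trans (by gcongr)
      _ = _ := by ring
  have Fm0 : 0 ≤ intΩ Γ (fun x y => F x y ^ m) := intΩ_nonneg fun x y _ => pow_nonneg (F0 x y) m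
  have H4 : (intΩ Γ (fun x y => F x y ^ s)) ^ (1 / s) ≤
      (2 ^ (m - 1) * D * 2) ^ (1 / (m:ℝ)) * ((Γ ^ (1 / t)) ^ (1 / s)) * (EE Γ a + EE Γ b) := by
    calc _ ≤ ((intΩ Γ (fun x y => F x y ^ m)) ^ (1 / (m / s)) * Γ ^ (1 / t)) ^ (1 / s) := by
          apply Real.rpow_le_rpow (intΩ_nonneg fun x y _ => Real.rpow_nonneg (F0 x y) _) H2
          positivity
      _ = (intΩ Γ (fun x y => F x y ^ m)) ^ (1 / (m:ℝ)) * (Γ ^ (1 / t)) ^ (1 / s) := by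
          rw [Real.mul_rpow (by positivity) (by positivity), ← Real.rpow_mul Fm0]
          congr 2
          field_simp
      _ ≤ ((2 ^ (m - 1) * D * 2) * (EE Γ a + EE Γ b) ^ m) ^ (1 / (m:ℝ))
            * (Γ ^ (1 / t)) ^ (1 / s) := by
          gcongr
      _ = _ := by
          rw [Real.mul_rpow (by positivity) (by positivity), one_div (m:ℝ),
            Real.pow_rpow_inv_natCast (by positivity) hmn]
          ring
  refine H1.trans ?_
  gcongr

lemma q1_zero {b : SField} {c : ℝ} (h : ∀ x, b x c = 0) (x : ℝ) : q1 b x c = 0 := by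
  unfold q1
  simp [h]

lemma vel_J {Γ : ℝ} (hΓ : 0 < Γ) {a b : SField} (ha : ssmooth a) (hb : ssmooth b)
    (pa : speriodic Γ a) (pb : speriodic Γ b)
    (hb0 : ∀ x1, b x1 0 = 0) (hb1 : ∀ x1, b x1 1 = 0) :
    intΩ Γ (fun x y => q1 a x y * q2 b x y - q2 a x y * q1 b x y) = 0 := by
  have ca : Continuous (fun q : ℝ × ℝ => a q.1 q.2) := ha.scont
  have cb1 : Continuous (fun q : ℝ × ℝ => q1 b q.1 q.2) := hb.q1.scont
  have cb2 : Continuous (fun q : ℝ × ℝ => q2 b q.1 q.2) := hb.q2.scont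
  have ca1 : Continuous (fun q : ℝ × ℝ => q1 a q.1 q.2) := ha.q1.scont
  have ca2 : Continuous (fun q : ℝ × ℝ => q2 a q.1 q.2) := ha.q2.scont
  have cb12 : Continuous (fun q : ℝ × ℝ => q1 (q2 b) q.1 q.2) := hb.q2.q1.scont
  have cb21 : Continuous (fun q : ℝ × ℝ => q2 (q1 b) q.1 q.2) := hb.q1.q2.scont
  have := intΩ_div hΓ (G := fun x y => a x y * q2 b x y) (H := fun x y => -(a x y * q1 b x y))
    (g := fun x y => q1 a x y * q2 b x y + a x y * q1 (q2 b) x y)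
    (h := fun x y => -(q2 a x y * q1 b x y + a x y * q2 (q1 b) x y))
    (by unfold scont; fun_prop) (by unfold scont; fun_prop)
    (fun x y => (ha.h1 x y).fun_mul (hb.q2.h1 x y))
    (fun x y => ((ha.h2 x y).fun_mul (hb.q1.h2 x y)).fun_neg)
    (fun y => by simp only [per0 pa, per0 (q2_per pb)])
    (fun x => by simp [q1_zero hb0]) (fun x => by simp [q1_zero hb1])
  rw [← this]
  congr 1; funext x y
  rw [hb.mixed]; ring

lemma vel_EJ {Γ : ℝ} (hΓ : 0 < Γ) {a b : SField} (ha : ssmooth a) (hb : ssmooth b)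
    (pa : speriodic Γ a) (pb : speriodic Γ b)
    (hb0 : ∀ x1, b x1 0 = 0) (hb1 : ∀ x1, b x1 1 = 0) :
    intΩ Γ (fun x y => (a x y ^ 2 + b x y ^ 2) *
    (q1 a x y * q2 b x y - q2 a x y * q1 b x y)) = 0 := by
  have ca : Continuous (fun q : ℝ × ℝ => a q.1 q.2) := ha.scont
  have cb : Continuous (fun q : ℝ × ℝ => b q.1 q.2) := hb.scont
  have cb1 : Continuous (fun q : ℝ × ℝ => q1 b q.1 q.2) := hb.q1.scont
  have cb2 : Continuous (fun q : ℝ × ℝ => q2 b q.1 q.2) := hb.q2.scont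
  have ca1 : Continuous (fun q : ℝ × ℝ => q1 a q.1 q.2) := ha.q1.scont
  have ca2 : Continuous (fun q : ℝ × ℝ => q2 a q.1 q.2) := ha.q2.scont
  have cb12 : Continuous (fun q : ℝ × ℝ => q1 (q2 b) q.1 q.2) := hb.q2.q1.scont
  have cb21 : Continuous (fun q : ℝ × ℝ => q2 (q1 b) q.1 q.2) := hb.q1.q2.scont
  have ca12 : Continuous (fun q : ℝ × ℝ => q1 (q2 a) q.1 q.2) := ha.q2.q1.scont
  have ca21 : Continuous (fun q : ℝ × ℝ => q2 (q1 a) q.1 q.2) := ha.q1.q2.scont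
  have := intΩ_div hΓ
    (G := fun x y => (a x y * a x y + b x y * b x y) * (a x y * q2 b x y - b x y * q2 a x y))
    (H := fun x y => -((a x y * a x y + b x y * b x y) * (a x y * q1 b x y - b x y * q1 a x y)))
    (g := fun x y => ((q1 a x y * a x y + a x y * q1 a x y) + (q1 b x y * b x y + b x y * q1 b x y))
        * (a x y * q2 b x y - b x y * q2 a x y) + (a x y * a x y + b x y * b x y) *
        ((q1 a x y * q2 b x y + a x y * q1 (q2 b) x y)
          - (q1 b x y * q2 a x y + b x y * q1 (q2 a) x y)))
    (h := fun x y => -(((q2 a x y * a x y + a x y * q2 a x y)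
        + (q2 b x y * b x y + b x y * q2 b x y))
        * (a x y * q1 b x y - b x y * q1 a x y) + (a x y * a x y + b x y * b x y) *
        ((q2 a x y * q1 b x y + a x y * q2 (q1 b) x y)
          - (q2 b x y * q1 a x y + b x y * q2 (q1 a) x y))))
    (by unfold scont; fun_prop) (by unfold scont; fun_prop)
    (fun x y => (((ha.h1 x y).fun_mul (ha.h1 x y)).fun_add ((hb.h1 x y).fun_mul (hb.h1 x y))).fun_mul
      (((ha.h1 x y).fun_mul (hb.q2.h1 x y)).fun_sub ((hb.h1 x y).fun_mul (ha.q2.h1 x y))))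
    (fun x y => ((((ha.h2 x y).fun_mul (ha.h2 x y)).fun_add
      ((hb.h2 x y).fun_mul (hb.h2 x y))).fun_mul
      (((ha.h2 x y).fun_mul (hb.q1.h2 x y)).fun_sub ((hb.h2 x y).fun_mul (ha.q1.h2 x y)))).fun_neg)
    (fun y => by simp only [per0 pa, per0 pb, per0 (q2_per pb), per0 (q2_per pa)])
    (fun x => by simp [q1_zero hb0, hb0]) (fun x => by simp [q1_zero hb1, hb1])
  have h4 : intΩ Γ (fun x y => 4 * ((a x y ^ 2 + b x y ^ 2) *
    (q1 a x y * q2 b x y - q2 a x y * q1 b x y))) = 0 := by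
    rw [← this]
    congr 1; funext x y
    rw [hb.mixed, ha.mixed]; ring
  rw [intΩ_const_mul] at h4
  linarith

lemma vel_grad {Γ : ℝ} (hΓ : 0 < Γ) {a b : SField} (ha : ssmooth a) (hb : ssmooth b)
    (pa : speriodic Γ a) (pb : speriodic Γ b)
    (hdiv : ∀ x1 x2, x2 ∈ Icc (0:ℝ) 1 → q1 a x1 x2 + q2 b x1 x2 = 0)
    (hb0 : ∀ x1, b x1 0 = 0) (hb1 : ∀ x1, b x1 1 = 0) :
    intΩ Γ (fun x y => q1 a x y ^ 2 + q2 a x y ^ 2 + q1 b x y ^ 2 + q2 b x y ^ 2)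
    = intΩ Γ (fun x y => (q1 b x y - q2 a x y) ^ 2) := by
  have cb1 : Continuous (fun q : ℝ × ℝ => q1 b q.1 q.2) := hb.q1.scont
  have cb2 : Continuous (fun q : ℝ × ℝ => q2 b q.1 q.2) := hb.q2.scont
  have ca1 : Continuous (fun q : ℝ × ℝ => q1 a q.1 q.2) := ha.q1.scont
  have ca2 : Continuous (fun q : ℝ × ℝ => q2 a q.1 q.2) := ha.q2.scont
  have h : intΩ Γ (fun x y => q1 a x y ^ 2 + q2 a x y ^ 2 + q1 b x y ^ 2 + q2 b x y ^ 2)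
    = intΩ Γ (fun x y => (q1 b x y - q2 a x y) ^ 2
      + (-2) * (q1 a x y * q2 b x y - q2 a x y * q1 b x y)) := by
    apply intΩ_congr (by unfold scont; fun_prop) (by unfold scont; fun_prop)
    intro x y hy
    linear_combination (q1 a x y + q2 b x y) * hdiv x y hy
  rw [h, intΩ_add (by unfold scont; fun_prop) (by unfold scont; fun_prop), intΩ_const_mul,
    vel_J hΓ ha hb pa pb hb0 hb1]
  ring

lemma vel_Egrad {Γ : ℝ} (hΓ : 0 < Γ) {a b : SField} (ha : ssmooth a) (hb : ssmooth b)
    (pa : speriodic Γ a) (pb : speriodic Γ b)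
    (hdiv : ∀ x1 x2, x2 ∈ Icc (0:ℝ) 1 → q1 a x1 x2 + q2 b x1 x2 = 0)
    (hb0 : ∀ x1, b x1 0 = 0) (hb1 : ∀ x1, b x1 1 = 0) :
    intΩ Γ (fun x y => (a x y ^ 2 + b x y ^ 2) *
      (q1 a x y ^ 2 + q2 a x y ^ 2 + q1 b x y ^ 2 + q2 b x y ^ 2))
    = intΩ Γ (fun x y => (a x y ^ 2 + b x y ^ 2) * (q1 b x y - q2 a x y) ^ 2) := by
  have ca : Continuous (fun q : ℝ × ℝ => a q.1 q.2) := ha.scont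
  have cb : Continuous (fun q : ℝ × ℝ => b q.1 q.2) := hb.scont
  have cb1 : Continuous (fun q : ℝ × ℝ => q1 b q.1 q.2) := hb.q1.scont
  have cb2 : Continuous (fun q : ℝ × ℝ => q2 b q.1 q.2) := hb.q2.scont
  have ca1 : Continuous (fun q : ℝ × ℝ => q1 a q.1 q.2) := ha.q1.scont
  have ca2 : Continuous (fun q : ℝ × ℝ => q2 a q.1 q.2) := ha.q2.scont
  have h : intΩ Γ (fun x y => (a x y ^ 2 + b x y ^ 2) *
      (q1 a x y ^ 2 + q2 a x y ^ 2 + q1 b x y ^ 2 + q2 b x y ^ 2))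
    = intΩ Γ (fun x y => (a x y ^ 2 + b x y ^ 2) * (q1 b x y - q2 a x y) ^ 2
      + (-2) * ((a x y ^ 2 + b x y ^ 2) * (q1 a x y * q2 b x y - q2 a x y * q1 b x y))) := by
    apply intΩ_congr (by unfold scont; fun_prop) (by unfold scont; fun_prop)
    intro x y hy
    linear_combination (a x y ^ 2 + b x y ^ 2) * (q1 a x y + q2 b x y) * hdiv x y hy
  rw [h, intΩ_add (by unfold scont; fun_prop) (by unfold scont; fun_prop), intΩ_const_mul,
    vel_EJ hΓ ha hb pa pb hb0 hb1]
  ring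

lemma vel_mean {Γ : ℝ} (hΓ : 0 < Γ) {a b : SField} (ha : ssmooth a) (hb : ssmooth b)
    (pa : speriodic Γ a)
    (hdiv : ∀ x1 x2, x2 ∈ Icc (0:ℝ) 1 → q1 a x1 x2 + q2 b x1 x2 = 0)
    (hb1 : ∀ x1, b x1 1 = 0) :
    intΩ Γ b = 0 := by
  have cb : Continuous (fun q : ℝ × ℝ => b q.1 q.2) := hb.scont
  have cb2 : Continuous (fun q : ℝ × ℝ => q2 b q.1 q.2) := hb.q2.scont
  have ca1 : Continuous (fun q : ℝ × ℝ => q1 a q.1 q.2) := ha.q1.scont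
  have := intΩ_div hΓ (G := fun x y => y * a x y) (H := fun x y => y * b x y)
    (g := fun x y => y * q1 a x y) (h := fun x y => 1 * b x y + y * q2 b x y)
    (by unfold scont; fun_prop) (by unfold scont; fun_prop)
    (fun x y => (ha.h1 x y).const_mul y)
    (fun x y => (hasDerivAt_id' y).fun_mul (hb.h2 x y))
    (fun y => by simp only [per0 pa])
    (fun x => by simp) (fun x => by simp [hb1])
  rw [← this]
  apply intΩ_congr (by unfold scont; fun_prop) (by unfold scont; fun_prop)
  intro x y hy
  linear_combination -y * hdiv x y hy


set_option maxHeartbeats 4000000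

/-- pressure bound
‖p‖_{H¹} ≤ C (Ls⁻¹‖∂₂u‖_{L²} + Pr⁻¹‖ω‖_{L²}‖ω‖_{L^r} + Ra‖T‖_{L²}). -/
theorem pressure_bound (Γ : ℝ) (hΓ : 0 < Γ) (r : ℝ) (hr : 2 < r) :
    ∃ C : ℝ, 0 < C ∧ ∀ (Ra Pr Ls : ℝ), 0 < Ra → 0 < Pr → 0 < Ls →
      ∀ p u1 u2 T : SField,
        ssmooth p → ssmooth u1 → ssmooth u2 → ssmooth T →
        speriodic Γ p → speriodic Γ u1 → speriodic Γ u2 → speriodic Γ T →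
        intΩ Γ (fun x1 x2 => p x1 x2) = 0 →
        (∀ x1 x2, x2 ∈ Icc (0:ℝ) 1 → q1 u1 x1 x2 + q2 u2 x1 x2 = 0) →
        (∀ x1, u2 x1 0 = 0) → (∀ x1, u2 x1 1 = 0) →
        (∀ x1, T x1 0 = 1) → (∀ x1, T x1 1 = 0) →
        (∀ x1 x2, x2 ∈ Icc (0:ℝ) 1 →
          q1 (q1 p) x1 x2 + q2 (q2 p) x1 x2 =
            -Pr⁻¹ * (q1 u1 x1 x2 ^ 2 + 2 * q1 u2 x1 x2 * q2 u1 x1 x2 + q2 u2 x1 x2 ^ 2)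
              + Ra * q2 T x1 x2) →
        (∀ x1, q2 p x1 1 = Ls⁻¹ * q1 u1 x1 1) →
        (∀ x1, -q2 p x1 0 = Ls⁻¹ * q1 u1 x1 0 - Ra) →
        sH1 Γ p ≤ C * (Ls⁻¹ *
            Real.sqrt (intΩ Γ (fun x1 x2 => q2 u1 x1 x2 ^ 2 + q2 u2 x1 x2 ^ 2))
          + Pr⁻¹ * sL2 Γ (fun x1 x2 => q1 u2 x1 x2 - q2 u1 x1 x2)
              * sLr Γ r (fun x1 x2 => q1 u2 x1 x2 - q2 u1 x1 x2)
          + Ra * sL2 Γ T) := by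
  obtain ⟨CH, hCH, hold⟩ := holder_est hΓ hr
  set κ : ℝ := 1 + Γ ^ 2 with hκ
  have hκ0 : 0 < κ := by positivity
  set K : ℝ := (8 / 3) * ((4 * κ + 2) + 8 * (CH * (1 + κ)) + 2) with hK
  have hK0 : 0 < K := by positivity
  refine ⟨Real.sqrt ((1 + κ) * K), by positivity, ?_⟩
  intro Ra Pr Ls hRa hPr hLs p u1 u2 T hp hu1 hb hT pp pu1 pb pT hmean hdiv hb0 hb1 hT0 hT1 hpoi
    hn1 hn0
  -- subtract the mean flow
  set c : ℝ := Γ⁻¹ * intΩ Γ u1 with hc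
  set a : SField := fun x y => u1 x y + (-c) with haDef
  have ha : ssmooth a := by
    unfold ssmooth at hu1 ⊢
    exact hu1.add contDiff_const
  have pa : speriodic Γ a := fun x y => by simp only [haDef, pu1 x y]
  have q1a : q1 u1 = q1 a := by funext x y; simp [q1, haDef]
  have q2a : q2 u1 = q2 a := by funext x y; simp [q2, haDef]
  have amean : intΩ Γ a = 0 := by
    have : intΩ Γ a = intΩ Γ u1 + intΩ Γ (fun _ _ => -c) :=
      intΩ_add hu1.scont (by unfold scont; fun_prop)
    rw [this, intΩ_const hΓ, hc]
    field_simp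
    ring
  simp only [q1a, q2a] at hdiv hpoi hn1 hn0 ⊢
  have cp : Continuous (fun q : ℝ × ℝ => p q.1 q.2) := hp.scont
  have cp1 : Continuous (fun q : ℝ × ℝ => q1 p q.1 q.2) := hp.q1.scont
  have cp2 : Continuous (fun q : ℝ × ℝ => q2 p q.1 q.2) := hp.q2.scont
  have cp11 : Continuous (fun q : ℝ × ℝ => q1 (q1 p) q.1 q.2) := hp.q1.q1.scont
  have cp22 : Continuous (fun q : ℝ × ℝ => q2 (q2 p) q.1 q.2) := hp.q2.q2.scont
  have cT : Continuous (fun q : ℝ × ℝ => T q.1 q.2) := hT.scont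
  have cT2 : Continuous (fun q : ℝ × ℝ => q2 T q.1 q.2) := hT.q2.scont
  have ca : Continuous (fun q : ℝ × ℝ => a q.1 q.2) := ha.scont
  have cb : Continuous (fun q : ℝ × ℝ => u2 q.1 q.2) := hb.scont
  have cb1 : Continuous (fun q : ℝ × ℝ => q1 u2 q.1 q.2) := hb.q1.scont
  have cb2 : Continuous (fun q : ℝ × ℝ => q2 u2 q.1 q.2) := hb.q2.scont
  have ca1 : Continuous (fun q : ℝ × ℝ => q1 a q.1 q.2) := ha.q1.scont
  have ca2 : Continuous (fun q : ℝ × ℝ => q2 a q.1 q.2) := ha.q2.scont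
  have cb12 : Continuous (fun q : ℝ × ℝ => q1 (q2 u2) q.1 q.2) := hb.q2.q1.scont
  have cb21 : Continuous (fun q : ℝ × ℝ => q2 (q1 u2) q.1 q.2) := hb.q1.q2.scont
  have ca12 : Continuous (fun q : ℝ × ℝ => q1 (q2 a) q.1 q.2) := ha.q2.q1.scont
  have ca21 : Continuous (fun q : ℝ × ℝ => q2 (q1 a) q.1 q.2) := ha.q1.q2.scont
  set l : ℝ := Ls⁻¹ with hl
  set ν : ℝ := Pr⁻¹ with hν
  have hl0 : 0 < l := by positivity
  have hν0 : 0 < ν := by positivity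
  -- the energy identity
  have ident := intΩ_div hΓ
    (G := fun x y => p x y * q1 p x y + l * (2 * y - 1) * (p x y * q2 a x y)
      - 2 * ν * (p x y * (a x y * q2 u2 x y)))
    (H := fun x y => p x y * q2 p x y - Ra * (p x y * T x y)
      - l * ((2 * y - 1) * (p x y * q1 a x y)) + 2 * ν * (p x y * (a x y * q1 u2 x y)))
    (g := fun x y => (q1 p x y * q1 p x y + p x y * q1 (q1 p) x y)
      + l * (2 * y - 1) * (q1 p x y * q2 a x y + p x y * q1 (q2 a) x y)
      - 2 * ν * (q1 p x y * (a x y * q2 u2 x y)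
        + p x y * (q1 a x y * q2 u2 x y + a x y * q1 (q2 u2) x y)))
    (h := fun x y => (q2 p x y * q2 p x y + p x y * q2 (q2 p) x y)
      - Ra * (q2 p x y * T x y + p x y * q2 T x y)
      - l * ((2 * 1) * (p x y * q1 a x y)
        + (2 * y - 1) * (q2 p x y * q1 a x y + p x y * q2 (q1 a) x y))
      + 2 * ν * (q2 p x y * (a x y * q1 u2 x y)
        + p x y * (q2 a x y * q1 u2 x y + a x y * q2 (q1 u2) x y)))
    (by unfold scont; fun_prop) (by unfold scont; fun_prop)
    (fun x y => (((hp.h1 x y).fun_mul (hp.q1.h1 x y)).fun_add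
      (((hp.h1 x y).fun_mul (ha.q2.h1 x y)).const_mul (l * (2 * y - 1)))).fun_sub
      (((hp.h1 x y).fun_mul ((ha.h1 x y).fun_mul (hb.q2.h1 x y))).const_mul (2 * ν)))
    (fun x y => ((((hp.h2 x y).fun_mul (hp.q2.h2 x y)).fun_sub
      (((hp.h2 x y).fun_mul (hT.h2 x y)).const_mul Ra)).fun_sub
      (((((hasDerivAt_id' y).const_mul 2).sub_const 1).fun_mul
        ((hp.h2 x y).fun_mul (ha.q1.h2 x y))).const_mul l)).fun_add
      (((hp.h2 x y).fun_mul ((ha.h2 x y).fun_mul (hb.q1.h2 x y))).const_mul (2 * ν)))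
    (fun y => by
      simp only [per0 pa, per0 pp, per0 (q1_per pp), per0 (q2_per pb), per0 (q2_per pa)])
    (fun x => by
      have := hn0 x
      simp only [q1_zero hb0, hT0]
      linear_combination -p x 0 * this)
    (fun x => by
      have := hn1 x
      simp only [q1_zero hb1, hT1]
      linear_combination p x 1 * this)
  -- pointwise Young inequality
  have young : ∀ x y, y ∈ Icc (0:ℝ) 1 →
      (q1 p x y ^ 2 + q2 p x y ^ 2) ≤
      ((q1 p x y * q1 p x y + p x y * q1 (q1 p) x y)
      + l * (2 * y - 1) * (q1 p x y * q2 a x y + p x y * q1 (q2 a) x y)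
      - 2 * ν * (q1 p x y * (a x y * q2 u2 x y)
        + p x y * (q1 a x y * q2 u2 x y + a x y * q1 (q2 u2) x y))
      + ((q2 p x y * q2 p x y + p x y * q2 (q2 p) x y)
      - Ra * (q2 p x y * T x y + p x y * q2 T x y)
      - l * ((2 * 1) * (p x y * q1 a x y)
        + (2 * y - 1) * (q2 p x y * q1 a x y + p x y * q2 (q1 a) x y))
      + 2 * ν * (q2 p x y * (a x y * q1 u2 x y)
        + p x y * (q2 a x y * q1 u2 x y + a x y * q2 (q1 u2) x y))))
      + ((4 * κ)⁻¹ * p x y ^ 2 + ((3 / 8) * (q1 p x y ^ 2 + q2 p x y ^ 2)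
        + (((4 * κ + 2) * l ^ 2) * (q2 a x y ^ 2 + q2 u2 x y ^ 2)
        + ((8 * ν ^ 2) * ((a x y ^ 2 + u2 x y ^ 2) *
            (q1 a x y ^ 2 + q2 a x y ^ 2 + q1 u2 x y ^ 2 + q2 u2 x y ^ 2))
        + (2 * Ra ^ 2) * T x y ^ 2)))) := by
    intro x y hy
    have hd : q1 a x y = - q2 u2 x y := by linarith [hdiv x y hy]
    have hpo := hpoi x y hy
    rw [ha.mixed, hb.mixed]
    have hpo' : q1 (q1 p) x y = -q2 (q2 p) x y +
      (-ν * (q1 a x y ^ 2 + 2 * q1 u2 x y * q2 a x y + q2 u2 x y ^ 2) + Ra * q2 T x y) := by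
      linarith
    rw [hpo', hd]
    generalize q1 p x y = P1
    generalize q2 p x y = P2
    generalize q2 (q2 p) x y = P22
    generalize q2 (q1 a) x y = A21
    generalize q2 (q1 u2) x y = B21
    generalize q2 a x y = A2
    generalize q1 u2 x y = B1
    generalize q2 u2 x y = B2
    generalize q2 T x y = T2
    generalize p x y = P
    generalize a x y = A
    generalize u2 x y = B
    generalize T x y = TT
    obtain ⟨w, hw⟩ : ∃ w, w = 2 * y - 1 := ⟨_, rfl⟩
    rw [← hw]
    have hw2 : w ^ 2 ≤ 1 := by rw [hw]; nlinarith [hy.1, hy.2]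
    have y1 : -(2 * l * P * B2) ≤ (4 * κ)⁻¹ * P ^ 2 + 4 * κ * (l ^ 2 * B2 ^ 2) := by
      have : (4 * κ)⁻¹ * P ^ 2 + 4 * κ * (l ^ 2 * B2 ^ 2) + 2 * l * P * B2
        = (4 * κ)⁻¹ * (P + 4 * κ * (l * B2)) ^ 2 := by field_simp; ring
      have h0 : 0 ≤ (4 * κ)⁻¹ * (P + 4 * κ * (l * B2)) ^ 2 := by positivity
      linarith
    have y2 : -(l * w * (P2 * B2)) ≤ P2 ^ 2 / 8 + 2 * (l ^ 2 * B2 ^ 2) := by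
      have h0 : (l ^ 2 * B2 ^ 2) * w ^ 2 ≤ (l ^ 2 * B2 ^ 2) * 1 := by gcongr
      nlinarith [sq_nonneg (P2 + 4 * (l * w * B2))]
    have y3 : -(l * w * (P1 * A2)) ≤ P1 ^ 2 / 8 + 2 * (l ^ 2 * A2 ^ 2) := by
      have h0 : (l ^ 2 * A2 ^ 2) * w ^ 2 ≤ (l ^ 2 * A2 ^ 2) * 1 := by gcongr
      nlinarith [sq_nonneg (P1 + 4 * (l * w * A2))]
    have y4 : 2 * ν * (P1 * (A * B2)) ≤ P1 ^ 2 / 8 + 8 * (ν ^ 2 * (A ^ 2 * B2 ^ 2)) := by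
      nlinarith [sq_nonneg (P1 - 8 * (ν * (A * B2)))]
    have y5 : -(2 * ν * (P2 * (A * B1))) ≤ P2 ^ 2 / 8 + 8 * (ν ^ 2 * (A ^ 2 * B1 ^ 2)) := by
      nlinarith [sq_nonneg (P2 + 8 * (ν * (A * B1)))]
    have y6 : Ra * (P2 * TT) ≤ P2 ^ 2 / 8 + 2 * (Ra ^ 2 * TT ^ 2) := by
      nlinarith [sq_nonneg (P2 - 4 * (Ra * TT))]
    have y7 : 0 ≤ 8 * ν ^ 2 * (B ^ 2 * (B2 ^ 2 + A2 ^ 2 + B1 ^ 2 + B2 ^ 2)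
        + A ^ 2 * (B2 ^ 2 + A2 ^ 2)) := by positivity
    have y8 : 0 ≤ 4 * κ * l ^ 2 * A2 ^ 2 := by positivity
    have y9 : 0 ≤ P1 ^ 2 := sq_nonneg _
    linear_combination y1 + y2 + y3 + y4 + y5 + y6 + y7 + y8 + (1 / 8) * y9
  have young2 := intΩ_mono (Γ := Γ) (by unfold scont; fun_prop) (by unfold scont; fun_prop) young
  conv at young2 =>
    rhs
    rw [intΩ_add (by unfold scont; fun_prop) (by unfold scont; fun_prop), ident,
      intΩ_add (by unfold scont; fun_prop) (by unfold scont; fun_prop),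
      intΩ_add (by unfold scont; fun_prop) (by unfold scont; fun_prop),
      intΩ_add (by unfold scont; fun_prop) (by unfold scont; fun_prop),
      intΩ_add (by unfold scont; fun_prop) (by unfold scont; fun_prop),
      intΩ_const_mul, intΩ_const_mul, intΩ_const_mul, intΩ_const_mul, intΩ_const_mul,
      vel_Egrad hΓ ha hb pa pb hdiv hb0 hb1]
  have poip := poincare hΓ hp hmean
  have poia := poincare hΓ ha amean
  have poib := poincare hΓ hb (vel_mean hΓ ha hb pa hdiv hb1)
  have hgrad := vel_grad hΓ ha hb pa pb hdiv hb0 hb1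
  have cω : scont (fun x y => q1 u2 x y - q2 a x y) := by unfold scont; fun_prop
  have hH := hold a u2 (fun x y => q1 u2 x y - q2 a x y) ha hb cω
  have eEa : EE Γ a = intΩ Γ (fun x y => a x y ^ 2)
      + intΩ Γ (fun x y => q1 a x y ^ 2 + q2 a x y ^ 2) := by
    rw [← intΩ_add (by unfold scont; fun_prop) (by unfold scont; fun_prop), EE]
    congr 1; funext x y; ring
  have eEb : EE Γ u2 = intΩ Γ (fun x y => u2 x y ^ 2)
      + intΩ Γ (fun x y => q1 u2 x y ^ 2 + q2 u2 x y ^ 2) := by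
    rw [← intΩ_add (by unfold scont; fun_prop) (by unfold scont; fun_prop), EE]
    congr 1; funext x y; ring
  have eEp : intΩ Γ (fun x y => p x y ^ 2 + q1 p x y ^ 2 + q2 p x y ^ 2)
      = intΩ Γ (fun x y => p x y ^ 2)
      + intΩ Γ (fun x y => q1 p x y ^ 2 + q2 p x y ^ 2) := by
    rw [← intΩ_add (by unfold scont; fun_prop) (by unfold scont; fun_prop)]
    congr 1; funext x y; ring
  have eg : intΩ Γ (fun x y => q1 a x y ^ 2 + q2 a x y ^ 2 + q1 u2 x y ^ 2 + q2 u2 x y ^ 2)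
      = intΩ Γ (fun x y => q1 a x y ^ 2 + q2 a x y ^ 2)
      + intΩ Γ (fun x y => q1 u2 x y ^ 2 + q2 u2 x y ^ 2) := by
    rw [← intΩ_add (by unfold scont; fun_prop) (by unfold scont; fun_prop)]
    congr 1; funext x y; ring
  rw [eg] at hgrad
  rw [← hκ] at poip poia poib
  unfold sH1 sL2
  rw [eEp]
  have nD : 0 ≤ intΩ Γ (fun x y => q2 a x y ^ 2 + q2 u2 x y ^ 2) :=
    intΩ_nonneg fun x y _ => by positivity
  have nW : 0 ≤ intΩ Γ (fun x y => (q1 u2 x y - q2 a x y) ^ 2) :=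
    intΩ_nonneg fun x y _ => by positivity
  have nT : 0 ≤ intΩ Γ (fun x y => T x y ^ 2) := intΩ_nonneg fun x y _ => by positivity
  have nR : 0 ≤ sLr Γ r (fun x y => q1 u2 x y - q2 a x y) := by
    unfold sLr
    exact Real.rpow_nonneg (intΩ_nonneg fun x y _ => by positivity) _
  have hE : EE Γ a + EE Γ u2 ≤ (1 + κ) * intΩ Γ (fun x y => (q1 u2 x y - q2 a x y) ^ 2) := by
    rw [eEa, eEb, ← hgrad]
    linarith
  have hS : intΩ Γ (fun x y => (a x y ^ 2 + u2 x y ^ 2) * (q1 u2 x y - q2 a x y) ^ 2) ≤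
      CH * ((1 + κ) * intΩ Γ (fun x y => (q1 u2 x y - q2 a x y) ^ 2))
        * sLr Γ r (fun x y => q1 u2 x y - q2 a x y) ^ 2 :=
    hH.trans (by gcongr)
  generalize intΩ Γ (fun x y => (a x y ^ 2 + u2 x y ^ 2) * (q1 u2 x y - q2 a x y) ^ 2) = S at *
  generalize sLr Γ r (fun x y => q1 u2 x y - q2 a x y) = R at *
  generalize intΩ Γ (fun x y => (q1 u2 x y - q2 a x y) ^ 2) = W at *
  generalize intΩ Γ (fun x y => q2 a x y ^ 2 + q2 u2 x y ^ 2) = D at *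
  generalize intΩ Γ (fun x y => T x y ^ 2) = TT at *
  generalize intΩ Γ (fun x y => p x y ^ 2) = P0 at *
  generalize intΩ Γ (fun x y => q1 p x y ^ 2 + q2 p x y ^ 2) = PP at *
  have hP0 : (4 * κ)⁻¹ * P0 ≤ PP / 4 := by
    calc (4 * κ)⁻¹ * P0 ≤ (4 * κ)⁻¹ * (κ * PP) := by gcongr
      _ = PP / 4 := by field_simp
  have hS2 : 8 * ν ^ 2 * S ≤ 8 * ν ^ 2 * (CH * ((1 + κ) * W) * R ^ 2) := by gcongr
  obtain ⟨X, hX⟩ : ∃ X, X = l * √D := ⟨_, rfl⟩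
  obtain ⟨Y, hY⟩ : ∃ Y, Y = ν * √W * R := ⟨_, rfl⟩
  obtain ⟨Z, hZ⟩ : ∃ Z, Z = Ra * √TT := ⟨_, rfl⟩
  have hX0 : 0 ≤ X := by rw [hX]; positivity
  have hY0 : 0 ≤ Y := by rw [hY]; positivity
  have hZ0 : 0 ≤ Z := by rw [hZ]; positivity
  have hX2 : X ^ 2 = l ^ 2 * D := by rw [hX, mul_pow, Real.sq_sqrt nD]
  have hY2 : Y ^ 2 = ν ^ 2 * W * R ^ 2 := by rw [hY, mul_pow, mul_pow, Real.sq_sqrt nW]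
  have hZ2 : Z ^ 2 = Ra ^ 2 * TT := by rw [hZ, mul_pow, Real.sq_sqrt nT]
  rw [← hX, ← hY, ← hZ]
  have hPP : PP ≤ (8 / 3) * ((4 * κ + 2) * X ^ 2 + 8 * (CH * (1 + κ)) * Y ^ 2 + 2 * Z ^ 2) := by
    rw [hX2, hY2, hZ2]
    linarith
  have hsum : (4 * κ + 2) * X ^ 2 + 8 * (CH * (1 + κ)) * Y ^ 2 + 2 * Z ^ 2 ≤
      ((4 * κ + 2) + 8 * (CH * (1 + κ)) + 2) * (X + Y + Z) ^ 2 := by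
    have i1 : X ^ 2 ≤ (X + Y + Z) ^ 2 := by gcongr; linarith
    have i2 : Y ^ 2 ≤ (X + Y + Z) ^ 2 := by gcongr; linarith
    have i3 : Z ^ 2 ≤ (X + Y + Z) ^ 2 := by gcongr; linarith
    calc _ ≤ (4 * κ + 2) * (X + Y + Z) ^ 2 + 8 * (CH * (1 + κ)) * (X + Y + Z) ^ 2
          + 2 * (X + Y + Z) ^ 2 := by gcongr
      _ = _ := by ring
  have hPP2 : PP ≤ K * (X + Y + Z) ^ 2 := by
    rw [hK]
    linarith
  calc √(P0 + PP) ≤ √((1 + κ) * K * (X + Y + Z) ^ 2) := by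
        apply Real.sqrt_le_sqrt
        calc P0 + PP ≤ (1 + κ) * PP := by linarith
          _ ≤ (1 + κ) * (K * (X + Y + Z) ^ 2) := by gcongr
          _ = _ := by ring
    _ = √((1 + κ) * K) * (X + Y + Z) := by
        rw [Real.sqrt_mul (by positivity), Real.sqrt_sq (by positivity)]

end RB
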